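/- Let n ≥ 0. The k-linear map ⊕_{x∈Z(G)} ν^n_{G,x,α} : ⊕_{x∈Z(G)} H^n(G, k x̄) → HH^n(k_αG) induced on cohomology is injective, and the induced map ⊕_{x∈Z(G)} π^n_{G,x,α} : HH^n(k_αG) → ⊕_{x∈Z(G)} H^n(G, k x̄) is a left inverse of it; in particular the latter is surjective. -/

import Mathlib

/- Common setup: twisted group algebras modelled on their canonical basis.
An element of the twisted group algebra `k_αG` is modelled as a function `G → k`
(its coordinates in the basis `{ḡ : g ∈ G}`), and a Hochschild `n`-cochain
`Hom_k((k_αG)^{⊗n}, M)` is modelled by its values on basis tensors, i.e. as a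
function `(Fin n → G) → M`.  Similarly a group cochain `C^n(H, A)` is a function
`(Fin n → H) → A`; the one-dimensional module `k x̄` is modelled as `k` with the
action of `h` given by multiplication by the character `χ(h) = α(h,x)·α(x,h)⁻¹`. -/

namespace TwistedSym

section Defs

variable {k : Type*} [CommRing k] {G : Type*} [Group G] [DecidableEq G]
variable {M : Type*} [AddCommGroup M] [Module k M]
variable {H : Type*} [Group H]
variable {A : Type*} [AddCommGroup A] [DistribMulAction H A]

/-- The 2-cocycle condition `α(x,yz)α(y,z) = α(xy,z)α(x,y)`. -/
def IsCocycle (α : G → G → kˣ) : Prop :=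
  ∀ x y z : G, α x (y * z) * α y z = α (x * y) z * α x y

/-- Normalization `α(1,x) = α(x,1) = 1`. -/
def IsNormalized (α : G → G → kˣ) : Prop :=
  ∀ x : G, α 1 x = 1 ∧ α x 1 = 1

/-- `(L, R)` encode a `(k_αG, k_αG)`-bimodule structure on the `k`-module `M`:
`L g` is left multiplication by the basis element `ḡ` and `R g` is right
multiplication by `ḡ`. -/
def IsBimodule (α : G → G → kˣ) (L R : G → M →ₗ[k] M) : Prop :=
  (∀ m : M, L 1 m = m) ∧ (∀ m : M, R 1 m = m) ∧
  (∀ (g h : G) (m : M), L g (L h m) = (α g h : k) • L (g * h) m) ∧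
  (∀ (g h : G) (m : M), R h (R g m) = (α g h : k) • R (g * h) m) ∧
  (∀ (g h : G) (m : M), L g (R h m) = R h (L g m))

/-- The tuple of group elements appearing in the action of the transposition
`σ_{i0+1} = (i0+1, i0+2)` on `n`-cochains (0-indexed `i0 : Fin n`):
position `i0 - 1` gets `g_{i0-1}·g_{i0}`, position `i0` gets `g_{i0}⁻¹` and
position `i0 + 1` gets `g_{i0}·g_{i0+1}` (when these positions exist). -/
def swapTuple {n : ℕ} (i0 : Fin n) (g : Fin n → H) : Fin n → H := fun j =>
  if (j : ℕ) + 1 = (i0 : ℕ) then g j * g i0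
  else if j = i0 then (g i0)⁻¹
  else if (j : ℕ) = (i0 : ℕ) + 1 then g i0 * g j
  else g j

/-- The action of the transposition `σ_{i0+1} = (i0+1,i0+2) ∈ Σ_{n+1}` on Hochschild
`n`-cochains of the twisted group algebra `k_αG` with coefficients in the bimodule `M`.
All the `α`-scalars come from rewriting products and inverses of basis elements in
terms of basis elements: `ḡ·h̄ = α(g,h)·(gh)‾` and `ḡ⁻¹ = α(g,g⁻¹)⁻¹·(g⁻¹)‾`. -/
def hSigma (α : G → G → kˣ) (L R : G → M →ₗ[k] M) {n : ℕ} (i0 : Fin n)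
    (φ : (Fin n → G) → M) : (Fin n → G) → M := fun g =>
  -(((if 0 < (i0 : ℕ) then
        (α (g ⟨(i0 : ℕ) - 1, lt_of_le_of_lt (Nat.sub_le _ _) i0.isLt⟩) (g i0) : k) else 1) *
     (((α (g i0) (g i0)⁻¹)⁻¹ : kˣ) : k) *
     (if h : (i0 : ℕ) + 1 < n then (α (g i0) (g ⟨(i0 : ℕ) + 1, h⟩) : k) else 1)) •
    (if (i0 : ℕ) = 0 then
        L (g i0) (if (i0 : ℕ) + 1 = n then R (g i0) (φ (swapTuple i0 g)) else φ (swapTuple i0 g))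
      else (if (i0 : ℕ) + 1 = n then R (g i0) (φ (swapTuple i0 g)) else φ (swapTuple i0 g))))

/-- Staic's action of the transposition `σ_{i0+1} ∈ Σ_{n+1}` on group `n`-cochains
with values in an `H`-module `A`. -/
def gSigma {n : ℕ} (i0 : Fin n) (ψ : (Fin n → H) → A) : (Fin n → H) → A := fun h =>
  -(if (i0 : ℕ) = 0 then h i0 • ψ (swapTuple i0 h) else ψ (swapTuple i0 h))

/-- Staic's action of the transposition `σ_{i0+1} ∈ Σ_{n+1}` on group `n`-cochains
with values in the rank-one module `k` on which `H` acts through the character `χ`. -/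
def cSigma (χ : H → k) {n : ℕ} (i0 : Fin n) (ψ : (Fin n → H) → k) : (Fin n → H) → k := fun h =>
  -(if (i0 : ℕ) = 0 then χ (h i0) * ψ (swapTuple i0 h) else ψ (swapTuple i0 h))

/-- The `(n+1)`-tuple `g` with entries at positions `j, j+1` multiplied together. -/
def mergeAt {n : ℕ} (g : Fin (n + 1) → H) (j : Fin n) : Fin n → H := fun l =>
  if (l : ℕ) < (j : ℕ) then g (Fin.castSucc l)
  else if l = j then g (Fin.castSucc l) * g (Fin.succ l)
  else g (Fin.succ l)

/-- The Hochschild differential `δ^n` for the twisted group algebra `k_αG` with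
coefficients in the bimodule `M`, written on basis tensors (the scalar
`α(g_j, g_{j+1})` comes from `ḡ_j·ḡ_{j+1} = α(g_j,g_{j+1})·(g_jg_{j+1})‾`). -/
def hDiff (α : G → G → kˣ) (L R : G → M →ₗ[k] M) {n : ℕ}
    (φ : (Fin n → G) → M) : (Fin (n + 1) → G) → M := fun g =>
  L (g 0) (φ fun j => g j.succ)
    + ∑ j : Fin n, ((-1 : ℤ) ^ ((j : ℕ) + 1)) •
        ((α (g j.castSucc) (g j.succ) : k) • φ (mergeAt g j))
    + ((-1 : ℤ) ^ (n + 1)) • R (g (Fin.last n)) (φ fun j => g j.castSucc)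

/-- The group cohomology differential `∂^n` for cochains on `H` with values in the
`H`-module `A`. -/
def gDiff {n : ℕ} (ψ : (Fin n → H) → A) : (Fin (n + 1) → H) → A := fun h =>
  h 0 • ψ (fun j => h j.succ)
    + ∑ j : Fin n, ((-1 : ℤ) ^ ((j : ℕ) + 1)) • ψ (mergeAt h j)
    + ((-1 : ℤ) ^ (n + 1)) • ψ (fun j => h j.castSucc)

/-- The group cohomology differential `∂^n` for cochains on `H` with values in the
rank-one module `k` on which `H` acts through the character `χ`. -/
def cDiff (χ : H → k) {n : ℕ} (ψ : (Fin n → H) → k) : (Fin (n + 1) → H) → k := fun h =>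
  χ (h 0) * ψ (fun j => h j.succ)
    + ∑ j : Fin n, ((-1 : ℤ) ^ ((j : ℕ) + 1)) • ψ (mergeAt h j)
    + ((-1 : ℤ) ^ (n + 1)) • ψ (fun j => h j.castSucc)

/-- Left multiplication by the basis element `ḡ` on `k_αG` (modelled as `G → k`). -/
def Lmul (α : G → G → kˣ) (g : G) : (G → k) →ₗ[k] (G → k) where
  toFun a := fun y => (α g (g⁻¹ * y) : k) * a (g⁻¹ * y)
  map_add' a b := by funext y; simp [mul_add]
  map_smul' c a := by funext y; simp [smul_eq_mul]; ring

/-- Right multiplication by the basis element `ḡ` on `k_αG` (modelled as `G → k`). -/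
def Rmul (α : G → G → kˣ) (g : G) : (G → k) →ₗ[k] (G → k) where
  toFun a := fun y => (α (y * g⁻¹) g : k) * a (y * g⁻¹)
  map_add' a b := by funext y; simp [mul_add]
  map_smul' c a := by funext y; simp [smul_eq_mul]; ring

/-- Iterated right multiplication: `rmuls α [g₁,…,gₙ] v = v·ḡ₁·…·ḡₙ`. -/
def rmuls (α : G → G → kˣ) (l : List G) (v : G → k) : G → k :=
  l.foldl (fun w g => Rmul α g w) v

/-- Iterated right multiplication by inverses of basis elements:
`rinvs α [h₁,…,hₙ] v = v·h̄ₙ⁻¹·…·h̄₁⁻¹`, using `h̄⁻¹ = α(h,h⁻¹)⁻¹·(h⁻¹)‾`. -/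
def rinvs (α : G → G → kˣ) (l : List G) (v : G → k) : G → k :=
  l.foldr (fun h w => (((α h h⁻¹)⁻¹ : kˣ) : k) • Rmul α h⁻¹ w) v

/-- The character through which `h ∈ C_G(x)` acts on the module `k x̄`:
`χ(h) = α(h,x)·α(x,h)⁻¹`. -/
def chi (α : G → G → kˣ) (x : G) : G → k := fun h =>
  (α h x : k) * (((α x h)⁻¹ : kˣ) : k)

/-- The map `π^n_{G,x,α} : C^n(k_αG, k_αG) → C^n(C_G(x), k x̄)`: the value on
`(h₁,…,hₙ)` is the coefficient of the basis element `x̄` in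
`φ(h̄₁⊗…⊗h̄ₙ)·h̄ₙ⁻¹·…·h̄₁⁻¹` (identifying `k x̄` with `k`). -/
def piC (α : G → G → kˣ) (x : G) {n : ℕ} (φ : (Fin n → G) → (G → k)) :
    (Fin n → Subgroup.centralizer ({x} : Set G)) → k := fun h =>
  rinvs α (List.ofFn fun i => (h i : G)) (φ fun i => (h i : G)) x

/-- The same map as `piC` for a central element `x`, in which case `C_G(x) = G`:
`π^n_{G,x,α} : C^n(k_αG, k_αG) → C^n(G, k x̄)`. -/
def piZ (α : G → G → kˣ) (x : G) {n : ℕ} (φ : (Fin n → G) → (G → k)) :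
    (Fin n → G) → k := fun h =>
  rinvs α (List.ofFn h) (φ h) x

/-- The map `ν^n_{G,x,α} : C^n(G, k x̄) → C^n(k_αG, k_αG)` for `x ∈ Z(G)`:
`ψ ↦ (ḡ₁⊗…⊗ḡₙ ↦ ψ(g₁,…,gₙ)·x̄·ḡ₁·…·ḡₙ)` (identifying `k x̄` with `k`). -/
def nuZ (α : G → G → kˣ) (x : G) {n : ℕ} (ψ : (Fin n → G) → k) :
    (Fin n → G) → (G → k) := fun g =>
  ψ g • rmuls α (List.ofFn g) (Pi.single x 1)

/-- Iteration of the index map of a coset decomposition along a list of group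
elements: `chainIdx idx j [g₁,…,gᵢ]` is the index `s_j^i`. -/
def chainIdx {m : ℕ} (idx : Fin m → G → Fin m) (j : Fin m) : List G → Fin m
  | [] => j
  | a :: l => chainIdx idx (idx j a) l

/-- The map `ν^n_{G,x} : C^n(C_G(x), kx) → C^n(kG, kG)` for the (untwisted) group
algebra, relative to a right coset decomposition `G = ⋃ⱼ C_G(x)γⱼ`:
`ν(ψ)(g₁⊗…⊗gₙ) = Σⱼ ψ(h_{j,1},…,h_{j,n})·x⁻¹·xⱼ·g₁⋯gₙ` where
`xⱼ = γⱼ⁻¹xγⱼ`, the `h_{j,i} = rep (s_j^{i-1}) gᵢ ∈ C_G(x)` are determined by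
`γ_{s_j^{i-1}}·gᵢ = h_{j,i}·γ_{s_j^i}` and `kx` is identified with `k`. -/
def nuT (x : G) {m n : ℕ} (γ : Fin m → G) (idx : Fin m → G → Fin m)
    (rep : Fin m → G → G)
    (hrep : ∀ j a, rep j a ∈ Subgroup.centralizer ({x} : Set G))
    (ψ : (Fin n → Subgroup.centralizer ({x} : Set G)) → k) :
    (Fin n → G) → (G → k) := fun g =>
  ∑ j : Fin m,
    ψ (fun i => ⟨rep (chainIdx idx j ((List.ofFn g).take (i : ℕ))) (g i), hrep _ _⟩) •
      (Pi.single ((γ j)⁻¹ * x * γ j * (List.ofFn g).prod) (1 : k) : G → k)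

/-- `φ` is a Hochschild coboundary (for `n = 0` the coboundary space is `0`). -/
def IsHCoboundary (α : G → G → kˣ) (L R : G → M →ₗ[k] M) :
    ∀ {n : ℕ}, ((Fin n → G) → M) → Prop
  | 0, φ => φ = 0
  | _ + 1, φ => ∃ θ, φ = hDiff α L R θ

/-- `φ` is the Hochschild coboundary of a `Σ`-invariant cochain. -/
def IsHSCoboundary (α : G → G → kˣ) (L R : G → M →ₗ[k] M) :
    ∀ {n : ℕ}, ((Fin n → G) → M) → Prop
  | 0, φ => φ = 0
  | _ + 1, φ => ∃ θ, (∀ i0, hSigma α L R i0 θ = θ) ∧ φ = hDiff α L R θ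

/-- `ψ` is a group-cohomology coboundary (coefficients in `k` through `χ`). -/
def IsCCoboundary (χ : H → k) : ∀ {n : ℕ}, ((Fin n → H) → k) → Prop
  | 0, ψ => ψ = 0
  | _ + 1, ψ => ∃ θ, ψ = cDiff χ θ

/-- `ψ` is the coboundary of a `Σ`-invariant group cochain (coefficients through `χ`). -/
def IsCSCoboundary (χ : H → k) : ∀ {n : ℕ}, ((Fin n → H) → k) → Prop
  | 0, ψ => ψ = 0
  | _ + 1, ψ => ∃ θ, (∀ i0, cSigma χ i0 θ = θ) ∧ ψ = cDiff χ θ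

/-- `ψ` is a group-cohomology coboundary (coefficients in the `H`-module `A`). -/
def IsGCoboundary : ∀ {n : ℕ}, ((Fin n → H) → A) → Prop
  | 0, ψ => ψ = 0
  | _ + 1, ψ => ∃ θ, ψ = gDiff θ

/-- `ψ` is the coboundary of a `Σ`-invariant group cochain (coefficients in `A`). -/
def IsGSCoboundary : ∀ {n : ℕ}, ((Fin n → H) → A) → Prop
  | 0, ψ => ψ = 0
  | _ + 1, ψ => ∃ θ, (∀ i0, gSigma i0 θ = θ) ∧ ψ = gDiff θ

end Defs

section Helpers

variable {k : Type*} [CommRing k] {G : Type*} [Group G]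

theorem Lmul_apply (α : G → G → kˣ) (g : G) (v : G → k) (y : G) :
    Lmul α g v y = (α g (g⁻¹ * y) : k) * v (g⁻¹ * y) := rfl

theorem Rmul_apply (α : G → G → kˣ) (g : G) (v : G → k) (y : G) :
    Rmul α g v y = (α (y * g⁻¹) g : k) * v (y * g⁻¹) := rfl

theorem rmuls_cons (α : G → G → kˣ) (g : G) (l : List G) (v : G → k) :
    rmuls α (g :: l) v = rmuls α l (Rmul α g v) := rfl

theorem rinvs_cons (α : G → G → kˣ) (g : G) (l : List G) (v : G → k) :
    rinvs α (g :: l) v = (((α g g⁻¹)⁻¹ : kˣ) : k) • Rmul α g⁻¹ (rinvs α l v) := rfl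

theorem rmuls_smul (α : G → G → kˣ) (l : List G) (c : k) (v : G → k) :
    rmuls α l (c • v) = c • rmuls α l v := by
  induction l generalizing v with
  | nil => rfl
  | cons g l ih => simp only [rmuls_cons, map_smul, ih]

/-- `rinvs` as a linear map. -/
def rinvsLin (α : G → G → kˣ) (l : List G) : (G → k) →ₗ[k] (G → k) where
  toFun := rinvs α l
  map_add' v w := by
    induction l with
    | nil => rfl
    | cons g l ih => simp only [rinvs_cons, ih, map_add, smul_add]
  map_smul' c v := by
    induction l with
    | nil => rfl
    | cons g l ih => simp only [rinvs_cons, ih, map_smul, RingHom.id_apply, smul_comm c]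

theorem rinvsLin_apply (α : G → G → kˣ) (l : List G) (v : G → k) :
    rinvsLin α l v = rinvs α l v := rfl

theorem Rmul_Rmul {α : G → G → kˣ} (hα : IsCocycle α) (g h : G) (v : G → k) :
    Rmul α h (Rmul α g v) = (α g h : k) • Rmul α (g * h) v := by
  funext y
  have key := congrArg (Units.val) (hα (y * h⁻¹ * g⁻¹) g h)
  simp only [Units.val_mul, inv_mul_cancel_right] at key
  simp only [Rmul_apply, Pi.smul_apply, smul_eq_mul, mul_inv_rev, ← mul_assoc] at key ⊢
  linear_combination (-v (y * h⁻¹ * g⁻¹)) * key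

theorem Lmul_Rmul {α : G → G → kˣ} (hα : IsCocycle α) (g h : G) (v : G → k) :
    Lmul α g (Rmul α h v) = Rmul α h (Lmul α g v) := by
  funext y
  have key := congrArg (Units.val) (hα g (g⁻¹ * y * h⁻¹) h)
  simp only [Units.val_mul, inv_mul_cancel_right, ← mul_assoc, mul_inv_cancel, one_mul] at key
  simp only [Rmul_apply, Lmul_apply, ← mul_assoc] at key ⊢
  linear_combination v (g⁻¹ * y * h⁻¹) * key

theorem mul_inv_cocycle {α : G → G → kˣ} (hα : IsCocycle α) (hnorm : IsNormalized α) (x g : G) :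
    α (x * g) g⁻¹ * α x g = α g g⁻¹ := by
  have h := hα x g g⁻¹
  rw [mul_inv_cancel, (hnorm x).2, one_mul] at h
  exact h.symm

theorem rinvs_rmuls {α : G → G → kˣ} (hα : IsCocycle α) (hnorm : IsNormalized α) (l : List G)
    (v : G → k) : rinvs α l (rmuls α l v) = v := by
  induction l generalizing v with
  | nil => rfl
  | cons g l ih =>
    rw [rmuls_cons, rinvs_cons, ih, Rmul_Rmul hα, mul_inv_cancel, smul_smul, Units.inv_mul,
      one_smul]
    funext y
    simp [Rmul_apply, (hnorm y).2]

theorem rmuls_rinvs {α : G → G → kˣ} (hα : IsCocycle α) (hnorm : IsNormalized α) (l : List G)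
    (v : G → k) : rmuls α l (rinvs α l v) = v := by
  induction l generalizing v with
  | nil => rfl
  | cons g l ih =>
    have hinv : (α g⁻¹ g : k) = α g g⁻¹ := by
      have h := hα g g⁻¹ g
      rw [mul_inv_cancel, inv_mul_cancel, (hnorm g).1, (hnorm g).2, one_mul, one_mul] at h
      rw [h]
    rw [rmuls_cons, rinvs_cons, map_smul, Rmul_Rmul hα, inv_mul_cancel, smul_smul, hinv,
      Units.inv_mul, one_smul]
    have : Rmul α (1 : G) (rinvs α l v) = rinvs α l v := by
      funext y
      simp [Rmul_apply, (hnorm y).2]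
    rw [this, ih]

theorem rmuls_append (α : G → G → kˣ) (l l' : List G) (v : G → k) :
    rmuls α (l ++ l') v = rmuls α l' (rmuls α l v) := List.foldl_append

theorem rmuls_ofFn_castSucc (α : G → G → kˣ) {n : ℕ} (g : Fin (n + 1) → G) (v : G → k) :
    rmuls α (List.ofFn g) v
      = Rmul α (g (Fin.last n)) (rmuls α (List.ofFn fun j => g j.castSucc) v) := by
  rw [List.ofFn_succ', List.concat_eq_append, rmuls_append]
  rfl

theorem Lmul_rmuls {α : G → G → kˣ} (hα : IsCocycle α) (g : G) (l : List G) (v : G → k) :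
    Lmul α g (rmuls α l v) = rmuls α l (Lmul α g v) := by
  induction l generalizing v with
  | nil => rfl
  | cons h l ih => rw [rmuls_cons, rmuls_cons, ih, Lmul_Rmul hα]

theorem mergeAt_zero {n : ℕ} (g : Fin (n + 2) → G) :
    mergeAt g 0 = Fin.cons (g 0 * g 1) fun j => g j.succ.succ := by
  funext l
  cases l using Fin.cases <;> simp [mergeAt]

theorem mergeAt_succ {n : ℕ} (g : Fin (n + 2) → G) (j : Fin n) :
    mergeAt g j.succ = Fin.cons (g 0) (mergeAt (fun i => g i.succ) j) := by
  funext l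
  cases l using Fin.cases <;> simp [mergeAt]

theorem rmuls_mergeAt {α : G → G → kˣ} (hα : IsCocycle α) {n : ℕ} (g : Fin (n + 1) → G)
    (j : Fin n) (v : G → k) :
    (α (g j.castSucc) (g j.succ) : k) • rmuls α (List.ofFn (mergeAt g j)) v
      = rmuls α (List.ofFn g) v := by
  induction n generalizing v with
  | zero => exact j.elim0
  | succ n ih =>
    cases j using Fin.cases with
    | zero =>
      rw [mergeAt_zero, List.ofFn_cons, List.ofFn_succ, List.ofFn_succ, rmuls_cons, rmuls_cons,
        rmuls_cons, Rmul_Rmul hα, rmuls_smul]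
      rfl
    | succ j =>
      rw [mergeAt_succ, List.ofFn_cons, List.ofFn_succ, rmuls_cons, rmuls_cons,
        ← ih (fun i => g i.succ) j]
      rfl

theorem rinvs_mergeAt {α : G → G → kˣ} (hα : IsCocycle α) (hnorm : IsNormalized α) {n : ℕ}
    (g : Fin (n + 1) → G) (j : Fin n) (v : G → k) :
    rinvs α (List.ofFn g) ((α (g j.castSucc) (g j.succ) : k) • v)
      = rinvs α (List.ofFn (mergeAt g j)) v := by
  rw [← rmuls_rinvs hα hnorm (List.ofFn (mergeAt g j)) v, rmuls_mergeAt hα,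
    rinvs_rmuls hα hnorm, rinvs_rmuls hα hnorm]

theorem rinvs_Rmul_last {α : G → G → kˣ} (hα : IsCocycle α) (hnorm : IsNormalized α) {n : ℕ}
    (g : Fin (n + 1) → G) (v : G → k) :
    rinvs α (List.ofFn g) (Rmul α (g (Fin.last n)) v)
      = rinvs α (List.ofFn fun j => g j.castSucc) v := by
  conv_lhs => rw [← rmuls_rinvs hα hnorm (List.ofFn fun j => g j.castSucc) v]
  rw [← rmuls_ofFn_castSucc, rinvs_rmuls hα hnorm]

theorem rinvs_Lmul {α : G → G → kˣ} (hα : IsCocycle α) (hnorm : IsNormalized α) (g : G)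
    (l : List G) (v : G → k) :
    rinvs α l (Lmul α g v) = Lmul α g (rinvs α l v) := by
  conv_lhs => rw [← rmuls_rinvs hα hnorm l v]
  rw [Lmul_rmuls hα, rinvs_rmuls hα hnorm]

theorem rinvs_cons_Lmul_apply {α : G → G → kˣ} (hα : IsCocycle α) (hnorm : IsNormalized α)
    {x : G} (hx : x ∈ Subgroup.center G) (g : G) (l : List G) (v : G → k) :
    rinvs α (g :: l) (Lmul α g v) x = chi α x g * rinvs α l v x := by
  have hxg : g⁻¹ * (x * g) = x := by
    rw [← Subgroup.mem_center_iff.1 hx g, inv_mul_cancel_left]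
  have key : ((α g g⁻¹)⁻¹ * α (x * g) g⁻¹ : kˣ) = (α x g)⁻¹ := by
    rw [← mul_inv_cocycle hα hnorm x g]
    simp
  have key' := congrArg Units.val key
  rw [Units.val_mul] at key'
  rw [rinvs_cons, rinvs_Lmul hα hnorm, Pi.smul_apply, smul_eq_mul, Rmul_apply, Lmul_apply,
    inv_inv, hxg, chi]
  linear_combination (α g x : k) * rinvs α l v x * key'

/-- `π` commutes with the differentials. -/
theorem piZ_hDiff {α : G → G → kˣ} (hα : IsCocycle α) (hnorm : IsNormalized α)
    {x : G} (hx : x ∈ Subgroup.center G) {n : ℕ} (φ : (Fin n → G) → (G → k)) :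
    piZ α x (hDiff α (Lmul α) (Rmul α) φ) = cDiff (chi α x) (piZ α x φ) := by
  funext g
  simp only [piZ, hDiff, cDiff, ← rinvsLin_apply, map_add, map_sum, map_zsmul]
  simp only [rinvsLin_apply, rinvs_mergeAt hα hnorm, rinvs_Rmul_last hα hnorm, Pi.add_apply,
    Finset.sum_apply, Pi.smul_apply]
  rw [List.ofFn_succ, rinvs_cons_Lmul_apply hα hnorm hx]

theorem Lmul_single [DecidableEq G] (α : G → G → kˣ) {x : G} (hx : x ∈ Subgroup.center G)
    (g : G) :
    Lmul α g (Pi.single x 1 : G → k) = chi α x g • Rmul α g (Pi.single x 1) := by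
  funext y
  have hc := Subgroup.mem_center_iff.1 hx g
  rw [Pi.smul_apply, smul_eq_mul, Lmul_apply, Rmul_apply, chi]
  by_cases hy : y = g * x
  · have h1 : g⁻¹ * y = x := by rw [hy, inv_mul_cancel_left]
    have h2 : y * g⁻¹ = x := by rw [hy, hc, mul_inv_cancel_right]
    simp [h1, h2]
  · have h1 : g⁻¹ * y ≠ x := fun h => hy (inv_mul_eq_iff_eq_mul.1 h)
    have h2 : y * g⁻¹ ≠ x := fun h => hy (by rw [hc, ← h, inv_mul_cancel_right])
    simp [h1, h2]

/-- `ν` commutes with the differentials. -/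
theorem hDiff_nuZ [DecidableEq G] {α : G → G → kˣ} (hα : IsCocycle α)
    {x : G} (hx : x ∈ Subgroup.center G) {n : ℕ} (ψ : (Fin n → G) → k) :
    hDiff α (Lmul α) (Rmul α) (nuZ α x ψ) = nuZ α x (cDiff (chi α x) ψ) := by
  funext g
  have hfirst : Lmul α (g 0) (rmuls α (List.ofFn fun j => g j.succ) (Pi.single x (1 : k)))
      = chi α x (g 0) • rmuls α (List.ofFn g) (Pi.single x 1) := by
    rw [Lmul_rmuls hα, Lmul_single α hx, rmuls_smul, List.ofFn_succ, rmuls_cons]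
  simp only [hDiff, nuZ, cDiff, map_smul, hfirst, add_smul, Finset.sum_smul,
    ← rmuls_ofFn_castSucc, smul_assoc]
  congr 2
  · rw [smul_smul, mul_comm]
  · refine Finset.sum_congr rfl fun j _ => ?_
    rw [smul_comm (α _ _ : k), rmuls_mergeAt hα]

/-- The composite of `π` and `ν` on cochains. -/
theorem piZ_nuZ [DecidableEq G] {α : G → G → kˣ} (hα : IsCocycle α) (hnorm : IsNormalized α)
    (x y : G) {n : ℕ} (ψ : (Fin n → G) → k) :
    piZ α x (nuZ α y ψ) = if x = y then ψ else 0 := by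
  funext g
  rw [piZ, nuZ, ← rinvsLin_apply, map_smul, rinvsLin_apply, rinvs_rmuls hα hnorm]
  by_cases h : x = y <;> simp [h]

theorem piZ_sum {ι : Type*} (α : G → G → kˣ) (x : G) {n : ℕ} (s : Finset ι)
    (φ : ι → (Fin n → G) → (G → k)) :
    piZ α x (∑ i ∈ s, φ i) = ∑ i ∈ s, piZ α x (φ i) := by
  funext g
  simp only [piZ, Finset.sum_apply, ← rinvsLin_apply, map_sum]

theorem hDiff_sum {ι : Type*} {M : Type*} [AddCommGroup M] [Module k M] (α : G → G → kˣ)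
    (L R : G → M →ₗ[k] M) {n : ℕ} (s : Finset ι) (φ : ι → (Fin n → G) → M) :
    hDiff α L R (∑ i ∈ s, φ i) = ∑ i ∈ s, hDiff α L R (φ i) := by
  funext g
  simp only [hDiff, Finset.sum_apply, map_sum, Finset.smul_sum, Finset.sum_add_distrib]
  rw [Finset.sum_comm]

theorem piZ_sum_nuZ [DecidableEq G] {α : G → G → kˣ} (hα : IsCocycle α) (hnorm : IsNormalized α)
    {x : G} {s : Finset G} (hx : x ∈ s) {n : ℕ} (ψf : G → (Fin n → G) → k) :
    piZ α x (∑ y ∈ s, nuZ α y (ψf y)) = ψf x := by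
  simp only [piZ_sum, piZ_nuZ hα hnorm, Finset.sum_ite_eq, if_pos hx]

theorem isCCoboundary_zero {H : Type*} [Group H] (χ : H → k) {n : ℕ} :
    IsCCoboundary χ (0 : (Fin n → H) → k) := by
  cases n with
  | zero => rfl
  | succ n => exact ⟨0, by funext h; simp [cDiff]⟩

/-- `π` maps Hochschild coboundaries to group-cohomology coboundaries. -/
theorem IsHCoboundary.piZ {α : G → G → kˣ} (hα : IsCocycle α) (hnorm : IsNormalized α)
    {x : G} (hx : x ∈ Subgroup.center G) {n : ℕ} {φ : (Fin n → G) → (G → k)}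
    (hφ : IsHCoboundary α (Lmul α) (Rmul α) φ) :
    IsCCoboundary (chi α x) (piZ α x φ) := by
  cases n with
  | zero =>
    have h0 : φ = 0 := hφ
    have : TwistedSym.piZ α x φ = 0 := by
      rw [h0]
      funext g
      rw [TwistedSym.piZ, ← rinvsLin_apply]
      exact congrFun (map_zero (rinvsLin α (List.ofFn g))) x
    exact this
  | succ n =>
    obtain ⟨θ, rfl⟩ := hφ
    exact ⟨TwistedSym.piZ α x θ, piZ_hDiff hα hnorm hx θ⟩

end Helpers

/-- the induced map `⊕_{x∈Z(G)} ν^n_{G,x,α} : ⊕_{x∈Z(G)} H^n(G,k x̄) →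
HH^n(k_αG)` is injective and the induced map `⊕_{x∈Z(G)} π^n_{G,x,α}` is a left
inverse of it on cohomology; in particular the latter is surjective. -/
theorem nu_embedding_pi_left_inverse
    {k : Type*} [Field k] {G : Type*} [Group G] [Fintype G] [DecidableEq G]
    [DecidablePred fun g : G => g ∈ Subgroup.center G]
    (α : G → G → kˣ) (hα : IsCocycle α) (hnorm : IsNormalized α) {n : ℕ} :
    (∀ ψf : G → (Fin n → G) → k,
      (∀ x ∈ Subgroup.center G, cDiff (chi α x) (ψf x) = 0) →
      IsHCoboundary α (Lmul α) (Rmul α)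
        (∑ y ∈ Finset.univ.filter (fun g : G => g ∈ Subgroup.center G), nuZ α y (ψf y)) →
      ∀ x ∈ Subgroup.center G, IsCCoboundary (chi α x) (ψf x)) ∧
    (∀ ψf : G → (Fin n → G) → k,
      (∀ x ∈ Subgroup.center G, cDiff (chi α x) (ψf x) = 0) →
      ∀ x ∈ Subgroup.center G,
        IsCCoboundary (chi α x)
          (piZ α x (∑ y ∈ Finset.univ.filter (fun g : G => g ∈ Subgroup.center G),
            nuZ α y (ψf y)) - ψf x)) ∧
    (∀ ψf : G → (Fin n → G) → k,
      (∀ x ∈ Subgroup.center G, cDiff (chi α x) (ψf x) = 0) →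
      ∃ φ : (Fin n → G) → (G → k), hDiff α (Lmul α) (Rmul α) φ = 0 ∧
        ∀ x ∈ Subgroup.center G, IsCCoboundary (chi α x) (piZ α x φ - ψf x)) := by
  have left : ∀ ψf : G → (Fin n → G) → k, ∀ x ∈ Subgroup.center G,
      piZ α x (∑ y ∈ Finset.univ.filter (fun g : G => g ∈ Subgroup.center G),
        nuZ α y (ψf y)) = ψf x := fun ψf x hx =>
    piZ_sum_nuZ hα hnorm (Finset.mem_filter.2 ⟨Finset.mem_univ x, hx⟩) ψf
  refine ⟨fun ψf _ hb x hx => ?_, fun ψf _ x hx => ?_, fun ψf hψ => ⟨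
    ∑ y ∈ Finset.univ.filter (fun g : G => g ∈ Subgroup.center G), nuZ α y (ψf y),
    ?_, fun x hx => ?_⟩⟩
  · rw [← left ψf x hx]
    exact hb.piZ hα hnorm hx
  · rw [left ψf x hx, sub_self]
    exact isCCoboundary_zero _
  · rw [hDiff_sum]
    refine Finset.sum_eq_zero fun y hy => ?_
    have hy' := (Finset.mem_filter.1 hy).2
    rw [hDiff_nuZ hα hy', hψ y hy']
    funext g
    simp [nuZ]
  · rw [left ψf x hx, sub_self]
    exact isCCoboundary_zero _

end TwistedSym
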